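/- (Lipschitz continuity of the Nadaraya–Watson projection.) Fix ε > 0, a nonempty finite index set J, points x_j ∈ ℝⁿ and feature vectors f_j ∈ ℝ^D for j ∈ J. Then the Nadaraya–Watson projection φ̃ : ℝⁿ → ℝ^D is Lipschitz continuous; i.e., there exists L ≥ 0 such that ‖φ̃(ξ₁) − φ̃(ξ₂)‖ ≤ L·‖ξ₁ − ξ₂‖ for all ξ₁, ξ₂ ∈ ℝⁿ. -/

import Mathlib

open Finset

/-- The Nadaraya–Watson projection with inverse-distance kernel `ω(d) = 1/(d+ε)`:
`φ̃(ξ) = (Σ_j w_j(ξ) f_j) / (Σ_j w_j(ξ))` with `w_j(ξ) = 1/(‖ξ − x_j‖ + ε)`. -/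
noncomputable def nwProj {n D : ℕ} {J : Type*} [Fintype J] (ε : ℝ)
    (x : J → EuclideanSpace ℝ (Fin n)) (f : J → EuclideanSpace ℝ (Fin D))
    (ξ : EuclideanSpace ℝ (Fin n)) : EuclideanSpace ℝ (Fin D) :=
  (∑ j : J, 1 / (‖ξ - x j‖ + ε))⁻¹ • ∑ j : J, (1 / (‖ξ - x j‖ + ε)) • f j

/-- A center of mass with nonnegative weights is bounded by any bound on the points. -/
theorem norm_centerMass_le {J E : Type*} [NormedAddCommGroup E] [NormedSpace ℝ E]
    {s : Finset J} {w : J → ℝ} {f : J → E} {M : ℝ} (hw : ∀ j ∈ s, 0 ≤ w j)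
    (hpos : 0 < ∑ j ∈ s, w j) (hf : ∀ j ∈ s, ‖f j‖ ≤ M) : ‖s.centerMass w f‖ ≤ M := by
  simpa using (convex_closedBall (0 : E) M).centerMass_mem hw hpos
    fun j hj => mem_closedBall_zero_iff.2 (hf j hj)

/-- A relative perturbation of the weights by at most `c` moves a center of mass of points of norm
at most `M` by at most `c * (2 * M)`. -/
theorem norm_centerMass_sub_centerMass_le {J E : Type*} [NormedAddCommGroup E] [NormedSpace ℝ E]
    {s : Finset J} {w v : J → ℝ} {f : J → E} {M c : ℝ} (hw : 0 < ∑ j ∈ s, w j)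
    (hv : ∀ j ∈ s, 0 ≤ v j) (hv' : 0 < ∑ j ∈ s, v j) (hf : ∀ j ∈ s, ‖f j‖ ≤ M)
    (hwv : ∀ j ∈ s, |w j - v j| ≤ c * w j) :
    ‖s.centerMass w f - s.centerMass v f‖ ≤ c * (2 * M) := by
  set p := s.centerMass v f with hp
  have hpM : ‖p‖ ≤ M := norm_centerMass_le hv hv' hf
  have hvp : ∑ j ∈ s, v j • f j = (∑ j ∈ s, v j) • p := by
    rw [hp, centerMass, smul_inv_smul₀ hv'.ne']
  have key : (∑ j ∈ s, w j) • (s.centerMass w f - p) = ∑ j ∈ s, (w j - v j) • (f j - p) := by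
    simp only [smul_sub, sub_smul, sum_sub_distrib, hvp, ← sum_smul]
    rw [centerMass, smul_inv_smul₀ hw.ne']
    abel
  refine le_of_mul_le_mul_left ?_ hw
  calc (∑ j ∈ s, w j) * ‖s.centerMass w f - p‖
      = ‖∑ j ∈ s, (w j - v j) • (f j - p)‖ := by
        rw [← key, norm_smul, Real.norm_of_nonneg hw.le]
    _ ≤ ∑ j ∈ s, c * w j * (2 * M) := by
        refine norm_sum_le_of_le _ fun j hj => ?_
        rw [norm_smul, Real.norm_eq_abs]
        have h : ‖f j - p‖ ≤ 2 * M := (norm_sub_le _ _).trans (by linarith [hf j hj])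
        exact mul_le_mul (hwv j hj) h (norm_nonneg _) ((abs_nonneg _).trans (hwv j hj))
    _ = (∑ j ∈ s, w j) * (c * (2 * M)) := by
        rw [sum_mul]
        exact sum_congr rfl fun j _ => by ring

/-- The inverse-distance kernel is relatively Lipschitz. -/
theorem abs_one_div_add_sub_one_div_add_le {a b ε : ℝ} (hε : 0 < ε) (ha : 0 ≤ a) (hb : 0 ≤ b) :
    |1 / (a + ε) - 1 / (b + ε)| ≤ |a - b| / ε * (1 / (a + ε)) := by
  have ha' : 0 < a + ε := by linarith
  have hb' : 0 < b + ε := by linarith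
  have h : 1 / (a + ε) - 1 / (b + ε) = (b - a) / (b + ε) * (1 / (a + ε)) := by
    field_simp
    ring
  rw [h, abs_mul, abs_div, abs_of_pos hb', abs_of_pos (one_div_pos.2 ha'), abs_sub_comm]
  gcongr
  linarith

/-- Lipschitz continuity of the Nadaraya–Watson projection. -/
theorem nwProj_lipschitz {n D : ℕ} {J : Type*} [Fintype J] [Nonempty J]
    (ε : ℝ) (hε : 0 < ε)
    (x : J → EuclideanSpace ℝ (Fin n)) (f : J → EuclideanSpace ℝ (Fin D)) :
    ∃ L : ℝ, 0 ≤ L ∧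
      ∀ ξ₁ ξ₂ : EuclideanSpace ℝ (Fin n),
        ‖nwProj ε x f ξ₁ - nwProj ε x f ξ₂‖ ≤ L * ‖ξ₁ - ξ₂‖ := by
  have hw : ∀ ξ j, 0 < 1 / (‖ξ - x j‖ + ε) := fun ξ j => by positivity
  have hW : ∀ ξ, 0 < ∑ j, 1 / (‖ξ - x j‖ + ε) := fun ξ =>
    sum_pos (fun j _ => hw ξ j) univ_nonempty
  refine ⟨2 * (∑ j, ‖f j‖) / ε, by positivity, fun ξ₁ ξ₂ => ?_⟩
  have h := norm_centerMass_sub_centerMass_le (c := ‖ξ₁ - ξ₂‖ / ε) (hW ξ₁)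
    (fun j _ => (hw ξ₂ j).le) (hW ξ₂)
    (fun j hj => single_le_sum (f := fun j => ‖f j‖) (fun i _ => norm_nonneg _) hj)
    fun j _ => (abs_one_div_add_sub_one_div_add_le hε (norm_nonneg (ξ₁ - x j))
      (norm_nonneg (ξ₂ - x j))).trans <| by
        gcongr
        simpa using abs_norm_sub_norm_le (ξ₁ - x j) (ξ₂ - x j)
  calc ‖nwProj ε x f ξ₁ - nwProj ε x f ξ₂‖ ≤ ‖ξ₁ - ξ₂‖ / ε * (2 * ∑ j, ‖f j‖) := h
    _ = 2 * (∑ j, ‖f j‖) / ε * ‖ξ₁ - ξ₂‖ := by ring
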